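/- Let (H, d) be a Hadamard space and let τ_M (Monod's co-convex topology) be the coarsest topology on H in which every metrically closed convex subset of H is closed. Then every τ_M-open set is weakly open; that is, τ_M is coarser than the weak topology τ_w. -/

import Mathlib

open Filter Topology

/-- A geodesic structure on a metric space: a geodesic map `G` satisfying the
constant-speed property and the CAT(0) comparison inequality. Together with
completeness of the metric this makes the space a Hadamard space. -/
structure GeodesicStructure (H : Type*) [MetricSpace H] where
  G : H → H → ℝ → H
  G_zero : ∀ x y, G x y 0 = x
  G_one : ∀ x y, G x y 1 = y
  G_dist : ∀ x y, ∀ s ∈ Set.Icc (0:ℝ) 1, ∀ t ∈ Set.Icc (0:ℝ) 1,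
    dist (G x y s) (G x y t) = |s - t| * dist x y
  cat0 : ∀ x y z : H, ∀ t ∈ Set.Icc (0:ℝ) 1,
    dist (G x y t) z ^ 2 ≤
      (1 - t) * dist x z ^ 2 + t * dist y z ^ 2 - t * (1 - t) * dist x y ^ 2

variable {H : Type*} [MetricSpace H]

/-- The geodesic segment `[x,y]`. -/
def seg (D : GeodesicStructure H) (x y : H) : Set H :=
  (fun t => D.G x y t) '' Set.Icc (0:ℝ) 1

/-- `P` is the metric-projection map: `P x y z` is the (unique) nearest point
to `z` on the geodesic segment `[x,y]`. -/
def IsProjMap (D : GeodesicStructure H) (P : H → H → H → H) : Prop :=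
  ∀ x y z : H, P x y z ∈ seg D x y ∧ ∀ q ∈ seg D x y, dist z (P x y z) ≤ dist z q

/-- The set `U_x(ε; y_1, …, y_k)` for the finite family `Y` of endpoints. -/
def elemSet (P : H → H → H → H) (x : H) (ε : ℝ) (Y : Finset H) : Set H :=
  {z : H | ∀ y ∈ Y, dist x (P x y z) < ε}

/-- A set is weakly open if each of its points admits a basic set
`U_x(ε; y_1, …, y_k)` inside it. -/
def WeaklyOpen (P : H → H → H → H) (U : Set H) : Prop :=
  ∀ x ∈ U, ∃ ε > (0:ℝ), ∃ Y : Finset H, Y.Nonempty ∧ elemSet P x ε Y ⊆ U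

/-- Weak convergence: `d(l, P_{[l,y]} x_n) → 0` for every `y`. -/
def WeakConv (P : H → H → H → H) (x : ℕ → H) (l : H) : Prop :=
  ∀ y : H, Tendsto (fun n => dist l (P l y (x n))) atTop (nhds 0)

/-- The space is weakly proper if every point is interior (w.r.t. the weak
topology) to each of its elementary sets. -/
def WeaklyProper (P : H → H → H → H) : Prop :=
  ∀ (x : H) (ε : ℝ), 0 < ε → ∀ y : H,
    ∃ V : Set H, WeaklyOpen P V ∧ x ∈ V ∧ V ⊆ elemSet P x ε {y}

/-- Geodesic convexity of a set. -/
def GConvex (D : GeodesicStructure H) (C : Set H) : Prop :=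
  ∀ a ∈ C, ∀ b ∈ C, ∀ t ∈ Set.Icc (0:ℝ) 1, D.G a b t ∈ C

/-- Monod's co-convex topology: the coarsest topology in which every metrically
closed convex set is closed, i.e. the topology generated by complements of
closed convex sets. -/
def tauM (D : GeodesicStructure H) : TopologicalSpace H :=
  TopologicalSpace.generateFrom
    {U : Set H | ∃ C : Set H, IsClosed C ∧ GConvex D C ∧ U = Cᶜ}

/-- In a Hadamard space every nonempty closed convex set contains a nearest point to `x`. -/
theorem GConvex.exists_nearest [CompleteSpace H] {D : GeodesicStructure H} {C : Set H}
    (hC : GConvex D C) (hcl : IsClosed C) (hne : C.Nonempty) (x : H) :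
    ∃ p ∈ C, ∀ c ∈ C, dist x p ≤ dist x c := by
  set δ := Metric.infDist x C
  have hδ0 : 0 ≤ δ := Metric.infDist_nonneg
  have hle : ∀ c ∈ C, δ ≤ dist x c := fun c hc => Metric.infDist_le_dist_of_mem hc
  have hseq : ∀ n : ℕ, ∃ c ∈ C, dist x c ^ 2 ≤ δ ^ 2 + 1 / ((n : ℝ) + 1) := by
    intro n
    have hn : (0 : ℝ) < 1 / ((n : ℝ) + 1) := by positivity
    have hlt : δ < √(δ ^ 2 + 1 / ((n : ℝ) + 1)) := Real.lt_sqrt_of_sq_lt (by linarith)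
    obtain ⟨c, hc, hxc⟩ := (Metric.infDist_lt_iff hne).1 hlt
    refine ⟨c, hc, ?_⟩
    rw [← Real.sq_sqrt (show 0 ≤ δ ^ 2 + 1 / ((n : ℝ) + 1) by positivity)]
    gcongr
  choose u huC hu using hseq
  have hlim : Tendsto (fun n : ℕ => 1 / ((n : ℝ) + 1)) atTop (𝓝 0) :=
    tendsto_one_div_add_atTop_nhds_zero_nat
  have hcauchy : CauchySeq u := by
    refine cauchySeq_of_le_tendsto_0 (fun N : ℕ => √(4 * (1 / ((N : ℝ) + 1)))) ?_ ?_
    · intro n m N hn hm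
      apply Real.le_sqrt_of_sq_le
      have hmid := D.cat0 (u n) (u m) x (1 / 2) ⟨by norm_num, by norm_num⟩
      have hmem := hle _ (hC _ (huC n) _ (huC m) (1 / 2) ⟨by norm_num, by norm_num⟩)
      rw [dist_comm x] at hmem
      have hsq := pow_le_pow_left₀ hδ0 hmem 2
      rw [dist_comm (u n) x, dist_comm (u m) x] at hmid
      have hn' : 1 / ((n : ℝ) + 1) ≤ 1 / ((N : ℝ) + 1) := Nat.one_div_le_one_div hn
      have hm' : 1 / ((m : ℝ) + 1) ≤ 1 / ((N : ℝ) + 1) := Nat.one_div_le_one_div hm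
      linarith [hu n, hu m]
    · simpa using (hlim.const_mul 4).sqrt
  obtain ⟨p, hp⟩ := cauchySeq_tendsto_of_complete hcauchy
  refine ⟨p, hcl.mem_of_tendsto hp (Eventually.of_forall huC), fun c hc => ?_⟩
  have hsq : dist x p ^ 2 ≤ δ ^ 2 := by
    refine le_of_tendsto_of_tendsto' ((tendsto_const_nhds.dist hp).pow 2) ?_ hu
    simpa using hlim.const_add (δ ^ 2)
  exact (le_of_sq_le_sq hsq hδ0).trans (hle c hc)

/-- If `p` is a nearest point of the convex set `C` to `q`, the angle at `p` between `q` and any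
point of `C` is at least `π / 2`. -/
theorem GConvex.dist_sq_add_dist_sq_le {D : GeodesicStructure H} {C : Set H} (hC : GConvex D C)
    {p q z : H} (hp : p ∈ C) (hq : ∀ c ∈ C, dist q p ≤ dist q c) (hz : z ∈ C) :
    dist q p ^ 2 + dist p z ^ 2 ≤ dist q z ^ 2 := by
  have key : ∀ t ∈ Set.Ioc (0 : ℝ) 1,
      dist q p ^ 2 + dist p z ^ 2 ≤ dist q z ^ 2 + t * dist p z ^ 2 := by
    intro t ht
    have ht' : t ∈ Set.Icc (0 : ℝ) 1 := ⟨ht.1.le, ht.2⟩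
    have hcat := D.cat0 p z q t ht'
    have hsq := pow_le_pow_left₀ dist_nonneg (hq _ (hC p hp z hz t ht')) 2
    rw [dist_comm (D.G p z t), dist_comm p q, dist_comm z q] at hcat
    refine le_of_mul_le_mul_left ?_ ht.1
    linarith
  have hlim : Tendsto (fun t : ℝ => dist q z ^ 2 + t * dist p z ^ 2) (𝓝[>] 0)
      (𝓝 (dist q z ^ 2)) := by
    have hcont : Continuous fun t : ℝ => dist q z ^ 2 + t * dist p z ^ 2 := by fun_prop
    simpa using (hcont.tendsto 0).mono_left nhdsWithin_le_nhds
  refine ge_of_tendsto hlim ?_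
  filter_upwards [Ioc_mem_nhdsGT (zero_lt_one' ℝ)] with t ht using key t ht

/-- Points of `[x, p]` split the distance from `x` to `p`. -/
theorem dist_add_dist_of_mem_seg {D : GeodesicStructure H} {x p q : H} (hq : q ∈ seg D x p) :
    dist x q + dist q p = dist x p := by
  obtain ⟨t, ht, rfl⟩ := hq
  have h0 := D.G_dist x p 0 ⟨le_rfl, zero_le_one⟩ t ht
  have h1 := D.G_dist x p t ht 1 ⟨zero_le_one, le_rfl⟩
  rw [D.G_zero, zero_sub, abs_neg, abs_of_nonneg ht.1] at h0
  rw [D.G_one, abs_sub_comm, abs_of_nonneg (sub_nonneg.2 ht.2)] at h1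
  simp only [h0, h1]
  ring

/-- If `p` is a nearest point of the convex set `C` to `x`, then every point of `C` projects
to `p` on the segment `[x, p]`. -/
theorem IsProjMap.eq_nearest {D : GeodesicStructure H} {P : H → H → H → H} (hP : IsProjMap D P)
    {C : Set H} (hC : GConvex D C) {x p z : H} (hp : p ∈ C)
    (hx : ∀ c ∈ C, dist x p ≤ dist x c) (hz : z ∈ C) : P x p z = p := by
  obtain ⟨hmem, hmin⟩ := hP x p z
  have hsplit := dist_add_dist_of_mem_seg hmem
  have hq : ∀ c ∈ C, dist (P x p z) p ≤ dist (P x p z) c := fun c hc => by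
    linarith [hx c hc, dist_triangle x (P x p z) c]
  have hpyth := hC.dist_sq_add_dist_sq_le hp hq hz
  have hle := pow_le_pow_left₀ dist_nonneg (hmin p ⟨1, ⟨zero_le_one, le_rfl⟩, D.G_one x p⟩) 2
  rw [dist_comm z, dist_comm z] at hle
  exact dist_eq_zero.1 (pow_eq_zero_iff two_ne_zero |>.1
    (le_antisymm (by linarith) (sq_nonneg _)))

/-- The complement of a closed convex set is weakly open. -/
theorem GConvex.weaklyOpen_compl [CompleteSpace H] {D : GeodesicStructure H}
    {P : H → H → H → H} (hP : IsProjMap D P) {C : Set H} (hC : GConvex D C)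
    (hcl : IsClosed C) : WeaklyOpen P Cᶜ := by
  intro x hx
  rcases C.eq_empty_or_nonempty with rfl | hne
  · exact ⟨1, one_pos, {x}, Finset.singleton_nonempty x, by simp⟩
  obtain ⟨p, hp, hmin⟩ := hC.exists_nearest hcl hne x
  refine ⟨dist x p, dist_pos.2 fun h => hx (h ▸ hp), {p}, Finset.singleton_nonempty p, ?_⟩
  intro z hz hzC
  have hlt := hz p (Finset.mem_singleton_self p)
  rw [hP.eq_nearest hC hp hmin hzC] at hlt
  exact lt_irrefl _ hlt

theorem weaklyOpen_univ (P : H → H → H → H) : WeaklyOpen P Set.univ :=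
  fun x _ => ⟨1, one_pos, {x}, Finset.singleton_nonempty x, Set.subset_univ _⟩

theorem WeaklyOpen.inter {P : H → H → H → H} {U V : Set H} (hU : WeaklyOpen P U)
    (hV : WeaklyOpen P V) : WeaklyOpen P (U ∩ V) := by
  classical
  rintro x ⟨hxU, hxV⟩
  obtain ⟨ε, hε, Y, hY, hYU⟩ := hU x hxU
  obtain ⟨η, hη, Z, -, hZV⟩ := hV x hxV
  refine ⟨min ε η, lt_min hε hη, Y ∪ Z, hY.mono Finset.subset_union_left, fun z hz => ⟨?_, ?_⟩⟩
  · exact hYU fun y hy => (hz y (Finset.mem_union_left Z hy)).trans_le (min_le_left _ _)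
  · exact hZV fun y hy => (hz y (Finset.mem_union_right Y hy)).trans_le (min_le_right _ _)

theorem weaklyOpen_sUnion {P : H → H → H → H} {S : Set (Set H)}
    (hS : ∀ U ∈ S, WeaklyOpen P U) : WeaklyOpen P (⋃₀ S) := by
  rintro x ⟨U, hUS, hxU⟩
  obtain ⟨ε, hε, Y, hY, hYU⟩ := hS U hUS x hxU
  exact ⟨ε, hε, Y, hY, hYU.trans (Set.subset_sUnion_of_mem hUS)⟩

/-- every `τ_M`-open set is weakly open, i.e. `τ_M ⊆ τ_w`. -/
theorem stmt18 [CompleteSpace H] (D : GeodesicStructure H) (P : H → H → H → H)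
    (hP : IsProjMap D P) (U : Set H) (hU : IsOpen[tauM D] U) :
    WeaklyOpen P U := by
  induction hU with
  | basic V hV =>
    obtain ⟨C, hcl, hC, rfl⟩ := hV
    exact hC.weaklyOpen_compl hP hcl
  | univ => exact weaklyOpen_univ P
  | inter V W _ _ hV hW => exact hV.inter hW
  | sUnion S _ hS => exact weaklyOpen_sUnion hS
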